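/- There exists a family (C_n) of alternating GFG parity automata with priorities {0,1,2}, of size linear in n over a fixed alphabet, such that every nondeterministic GFG parity automaton and every universal GFG parity automaton recognising L(C_n) has at least 2^{Ω(n)} states. -/

import Mathlib

namespace GFGPaper

/-- Positive Boolean formulas over `Q`. -/
inductive PosBool (Q : Type) : Type
  | atom : Q → PosBool Q
  | band : PosBool Q → PosBool Q → PosBool Q
  | bor  : PosBool Q → PosBool Q → PosBool Q

/-- A (positional) choice of Eve inside a positive Boolean formula:
she resolves every disjunction (possibly differently in different conjuncts). -/
inductive EveChoice {Q : Type} : PosBool Q → Type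
  | atom (q : Q) : EveChoice (PosBool.atom q)
  | band {φ ψ : PosBool Q} : EveChoice φ → EveChoice ψ → EveChoice (PosBool.band φ ψ)
  | borl {φ ψ : PosBool Q} : EveChoice φ → EveChoice (PosBool.bor φ ψ)
  | borr {φ ψ : PosBool Q} : EveChoice ψ → EveChoice (PosBool.bor φ ψ)

/-- The atoms that Adam (resolving conjunctions) can reach against Eve's choice. -/
def EveChoice.outcome {Q : Type} : {φ : PosBool Q} → EveChoice φ → Set Q
  | _, .atom q => {q}
  | _, .band c d => c.outcome ∪ d.outcome
  | _, .borl c => c.outcome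
  | _, .borr c => c.outcome

/-- A choice of Adam inside a positive Boolean formula: he resolves every conjunction. -/
inductive AdamChoice {Q : Type} : PosBool Q → Type
  | atom (q : Q) : AdamChoice (PosBool.atom q)
  | bandl {φ ψ : PosBool Q} : AdamChoice φ → AdamChoice (PosBool.band φ ψ)
  | bandr {φ ψ : PosBool Q} : AdamChoice ψ → AdamChoice (PosBool.band φ ψ)
  | bor {φ ψ : PosBool Q} : AdamChoice φ → AdamChoice ψ → AdamChoice (PosBool.bor φ ψ)

/-- The atoms Eve (resolving disjunctions) can reach against Adam's choice. -/
def AdamChoice.outcome {Q : Type} : {φ : PosBool Q} → AdamChoice φ → Set Q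
  | _, .atom q => {q}
  | _, .bandl c => c.outcome
  | _, .bandr c => c.outcome
  | _, .bor c d => c.outcome ∪ d.outcome

/-- The unique atom reached when Eve plays `e` and Adam plays `a` on the same formula. -/
def resolve {Q : Type} : {φ : PosBool Q} → EveChoice φ → AdamChoice φ → Q
  | _, .atom q, _ => q
  | _, .band c _, .bandl e => resolve c e
  | _, .band _ d, .bandr e => resolve d e
  | _, .borl c, .bor e _ => resolve c e
  | _, .borr c, .bor _ f => resolve c f

def InfOften (p : ℕ → Prop) : Prop := ∀ N, ∃ n, N ≤ n ∧ p n

/-- The parity condition: the maximal priority occurring infinitely often is even. -/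
def ParityAcc (c : ℕ → ℕ) : Prop :=
  ∃ p, Even p ∧ InfOften (fun n => c n = p) ∧ ∀ q, p < q → ¬ InfOften (fun n => c n = q)

/-- An alternating automaton with an abstract acceptance condition on
infinite sequences of transitions. -/
structure AltAut (A Q : Type) where
  init : Q
  δ : Q → A → PosBool Q
  acc : (ℕ → Q × A × Q) → Prop

def trace {A Q : Type} (w : ℕ → A) (ρ : ℕ → Q) : ℕ → Q × A × Q :=
  fun n => (ρ n, w n, ρ (n + 1))

/-- Acceptance via the model-checking game: Eve has a (history-dependent)
strategy resolving the disjunctions such that every consistent path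
(i.e. every way for Adam to resolve the conjunctions) is accepting. -/
def AltAut.Accepts {A Q : Type} (M : AltAut A Q) (w : ℕ → A) : Prop :=
  ∃ σ : List Q → (n : ℕ) → (q : Q) → EveChoice (M.δ q (w n)),
    ∀ ρ : ℕ → Q, ρ 0 = M.init →
      (∀ n, ρ (n + 1) ∈ (σ (List.ofFn fun i : Fin n => ρ i.val) n (ρ n)).outcome) →
      M.acc (trace w ρ)

/-- Eve wins her letter game: she resolves disjunctions online (knowing only the
play so far) so that whenever the word Adam produces is in the language,
the constructed path is accepting. -/
def ExistsGFG {A Q : Type} (M : AltAut A Q) : Prop :=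
  ∃ σ : List (A × Q) → (a : A) → (q : Q) → EveChoice (M.δ q a),
    ∀ (w : ℕ → A) (ρ : ℕ → Q), ρ 0 = M.init →
      (∀ n, ρ (n + 1) ∈
        (σ (List.ofFn fun i : Fin n => (w i.val, ρ (i.val + 1))) (w n) (ρ n)).outcome) →
      M.Accepts w → M.acc (trace w ρ)

/-- Adam wins his letter game: he resolves conjunctions online so that whenever the
word is not in the language, the constructed path is rejecting. -/
def ForallGFG {A Q : Type} (M : AltAut A Q) : Prop :=
  ∃ τ : List (A × Q) → (a : A) → (q : Q) → AdamChoice (M.δ q a),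
    ∀ (w : ℕ → A) (ρ : ℕ → Q), ρ 0 = M.init →
      (∀ n, ρ (n + 1) ∈
        (τ (List.ofFn fun i : Fin n => (w i.val, ρ (i.val + 1))) (w n) (ρ n)).outcome) →
      M.Accepts w ∨ ¬ M.acc (trace w ρ)

/-- Eve wins her letter game with a strategy that is positional in the expanded
letter game, i.e. depends only on the word read so far and the current state. -/
def EveWinsPositional {A Q : Type} (M : AltAut A Q) : Prop :=
  ∃ σ : List A → (a : A) → (q : Q) → EveChoice (M.δ q a),
    ∀ (w : ℕ → A) (ρ : ℕ → Q), ρ 0 = M.init →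
      (∀ n, ρ (n + 1) ∈ (σ (List.ofFn fun i : Fin n => w i.val) (w n) (ρ n)).outcome) →
      M.Accepts w → M.acc (trace w ρ)

/-- Alternating parity automaton (priorities on transitions). -/
structure APW (A Q : Type) where
  init : Q
  δ : Q → A → PosBool Q
  prio : Q → A → Q → ℕ

def APW.toAlt {A Q : Type} (M : APW A Q) : AltAut A Q :=
  { init := M.init, δ := M.δ,
    acc := fun t => ParityAcc fun n => M.prio (t n).1 (t n).2.1 (t n).2.2 }

def APW.Accepts {A Q : Type} (M : APW A Q) (w : ℕ → A) : Prop := M.toAlt.Accepts w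

def PosBool.dual {Q : Type} : PosBool Q → PosBool Q
  | .atom q => .atom q
  | .band φ ψ => .bor φ.dual ψ.dual
  | .bor φ ψ => .band φ.dual ψ.dual

/-- The dual automaton: swap ∧/∨ and increase all priorities by one. -/
def APW.dual {A Q : Type} (M : APW A Q) : APW A Q :=
  { init := M.init, δ := fun q a => (M.δ q a).dual,
    prio := fun q a q' => M.prio q a q' + 1 }

/-- The box of a positional Eve strategy on the one-step arena over `a`. -/
def stratBox {A Q : Type} (δ : Q → A → PosBool Q) (a : A)
    (σ : (q : Q) → EveChoice (δ q a)) : Set (Q × A × Q) :=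
  { t | t.2.1 = a ∧ t.2.2 ∈ (σ t.1).outcome }

def BoxesAt {A Q : Type} (δ : Q → A → PosBool Q) (a : A) : Set (Set (Q × A × Q)) :=
  Set.range (stratBox δ a)

def Boxes {A Q : Type} (δ : Q → A → PosBool Q) : Set (Set (Q × A × Q)) :=
  ⋃ a, BoxesAt δ a

/-- A sequence of boxes is universally accepting if every path through it is accepting. -/
def UnivAcc {A Q : Type} (M : AltAut A Q) (β : ℕ → Set (Q × A × Q)) : Prop :=
  ∀ (ρ : ℕ → Q) (wa : ℕ → A), ρ 0 = M.init →
    (∀ n, (ρ n, wa n, ρ (n + 1)) ∈ β n) →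
    M.acc (fun n => (ρ n, wa n, ρ (n + 1)))

/-- Deterministic parity automaton (priorities on transitions). -/
structure DPA (A P : Type) where
  init : P
  step : P → A → P
  prio : P → A → ℕ

def DPA.run {A P : Type} (D : DPA A P) (w : ℕ → A) : ℕ → P
  | 0 => D.init
  | n + 1 => D.step (DPA.run D w n) (w n)

def DPA.Accepts {A P : Type} (D : DPA A P) (w : ℕ → A) : Prop :=
  ParityAcc fun n => D.prio (D.run w n) (w n)

def pref {A : Type} (w : ℕ → A) (n : ℕ) : List A := List.ofFn fun i : Fin n => w i.val

/-- Nondeterministic parity automaton. -/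
structure NPA (A P : Type) where
  init : P
  Δ : P → A → Set P
  prio : P → A → P → ℕ

def NPA.IsRun {A P : Type} (N : NPA A P) (w : ℕ → A) (ρ : ℕ → P) : Prop :=
  ρ 0 = N.init ∧ ∀ n, ρ (n + 1) ∈ N.Δ (ρ n) (w n)

def NPA.Accepts {A P : Type} (N : NPA A P) (w : ℕ → A) : Prop :=
  ∃ ρ, N.IsRun w ρ ∧ ParityAcc fun n => N.prio (ρ n) (w n) (ρ (n + 1))

/-- A nondeterministic automaton is GFG if its nondeterminism can be resolved
based only on the prefix of the word read so far. -/
def NPA.GFG {A P : Type} (N : NPA A P) : Prop :=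
  ∃ f : List A → P, f [] = N.init ∧ (∀ u a, f (u ++ [a]) ∈ N.Δ (f u) a) ∧
    ∀ w : ℕ → A, N.Accepts w →
      ParityAcc fun n => N.prio (f (pref w n)) (w n) (f (pref w (n + 1)))

/-- Universal parity automaton. -/
structure UPA (A P : Type) where
  init : P
  Δ : P → A → Set P
  prio : P → A → P → ℕ

def UPA.IsRun {A P : Type} (N : UPA A P) (w : ℕ → A) (ρ : ℕ → P) : Prop :=
  ρ 0 = N.init ∧ ∀ n, ρ (n + 1) ∈ N.Δ (ρ n) (w n)

def UPA.Accepts {A P : Type} (N : UPA A P) (w : ℕ → A) : Prop :=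
  ∀ ρ, N.IsRun w ρ → ParityAcc fun n => N.prio (ρ n) (w n) (ρ (n + 1))

/-- A universal automaton is GFG if its universality can be resolved online:
on every word outside the language the produced run is rejecting. -/
def UPA.GFG {A P : Type} (N : UPA A P) : Prop :=
  ∃ f : List A → P, f [] = N.init ∧ (∀ u a, f (u ++ [a]) ∈ N.Δ (f u) a) ∧
    ∀ w : ℕ → A, ¬ N.Accepts w →
      ¬ ParityAcc fun n => N.prio (f (pref w n)) (w n) (f (pref w (n + 1)))

/-- A run of the box automaton `A^□` over `w` is a sequence of boxes. -/
def BoxRun {A Q : Type} (M : APW A Q) (w : ℕ → A) (β : ℕ → Set (Q × A × Q)) : Prop :=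
  ∀ n, β n ∈ BoxesAt M.δ (w n)

/-- Acceptance of the box automaton `A^□` built on a deterministic automaton `B`
over boxes: some box run is accepted by `B`. -/
def boxAccepts {A Q P : Type} (M : APW A Q) (B : DPA (Set (Q × A × Q)) P)
    (w : ℕ → A) : Prop :=
  ∃ β, BoxRun M w β ∧ B.Accepts β

/-- GFGness of the box automaton `A^□`: the box (its only nondeterminism) can be
chosen based only on the prefix of the word read. -/
def boxGFG {A Q P : Type} (M : APW A Q) (B : DPA (Set (Q × A × Q)) P) : Prop :=
  ∃ g : List A → A → Set (Q × A × Q),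
    (∀ u a, g u a ∈ BoxesAt M.δ a) ∧
    ∀ w : ℕ → A, boxAccepts M B w → B.Accepts (fun n => g (pref w n) (w n))

/-- A Rabin/Streett pair of sets of transitions. -/
structure RabinPair (T : Type) where
  bad : Set T
  good : Set T

def RabinAcc {T : Type} (pairs : Set (RabinPair T)) (t : ℕ → T) : Prop :=
  ∃ p ∈ pairs, (¬ InfOften fun n => t n ∈ p.bad) ∧ InfOften fun n => t n ∈ p.good

def StreettAcc {T : Type} (pairs : Set (RabinPair T)) (t : ℕ → T) : Prop :=
  ∀ p ∈ pairs, (¬ InfOften fun n => t n ∈ p.bad) ∨ InfOften fun n => t n ∈ p.good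

/-- Alternating Rabin automaton. -/
structure ARW (A Q : Type) where
  init : Q
  δ : Q → A → PosBool Q
  pairs : Set (RabinPair (Q × A × Q))

def ARW.toAlt {A Q : Type} (M : ARW A Q) : AltAut A Q :=
  { init := M.init, δ := M.δ, acc := RabinAcc M.pairs }

/-- Alternating Streett automaton. -/
structure ASW (A Q : Type) where
  init : Q
  δ : Q → A → PosBool Q
  pairs : Set (RabinPair (Q × A × Q))

def ASW.toAlt {A Q : Type} (M : ASW A Q) : AltAut A Q :=
  { init := M.init, δ := M.δ, acc := StreettAcc M.pairs }

end GFGPaper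

namespace GFGPaper

section Parity

lemma infOften_shift {p : ℕ → Prop} (k : ℕ) : InfOften (fun n => p (n + k)) ↔ InfOften p := by
  constructor
  · intro h N
    obtain ⟨n, hn, hp⟩ := h N
    exact ⟨n + k, by omega, hp⟩
  · intro h N
    obtain ⟨n, hn, hp⟩ := h (N + k)
    exact ⟨n - k, by omega, by simpa [Nat.sub_add_cancel (show k ≤ n by omega)] using hp⟩

lemma parityAcc_shift {c : ℕ → ℕ} (k : ℕ) : ParityAcc (fun n => c (n + k)) ↔ ParityAcc c := by
  unfold ParityAcc
  refine exists_congr fun p => and_congr Iff.rfl (and_congr ?_ (forall_congr' fun q => ?_))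
  · exact infOften_shift (p := fun n => c n = p) k
  · exact imp_congr Iff.rfl (not_congr (infOften_shift (p := fun n => c n = q) k))

lemma not_infOften_of_eventually_le {c : ℕ → ℕ} {p q N : ℕ} (hle : ∀ n, N ≤ n → c n ≤ p)
    (hpq : p < q) : ¬ InfOften fun n => c n = q := by
  intro h
  obtain ⟨n, hn, hc⟩ := h N
  have := hle n hn
  omega

/-- If the largest priority seen infinitely often is `p`, acceptance is the parity of `p`. -/
lemma parityAcc_iff_even {c : ℕ → ℕ} {p N : ℕ} (hle : ∀ n, N ≤ n → c n ≤ p)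
    (hp : InfOften fun n => c n = p) : ParityAcc c ↔ Even p := by
  constructor
  · rintro ⟨q, hq, hqi, hmax⟩
    rcases lt_trichotomy p q with h | h | h
    · exact absurd hqi (not_infOften_of_eventually_le hle h)
    · rwa [h]
    · exact absurd hp (hmax p h)
  · exact fun h => ⟨p, h, hp, fun q hq => not_infOften_of_eventually_le hle hq⟩

/-- A bounded sequence of priorities has a largest priority seen infinitely often. -/
lemma exists_limsup_priority {c : ℕ → ℕ} {B : ℕ} (hB : ∀ n, c n < B) :
    ∃ p N, (∀ n, N ≤ n → c n ≤ p) ∧ InfOften fun n => c n = p := by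
  classical
  have hex : ∃ p N, ∀ n, N ≤ n → c n ≤ p := ⟨B, 0, fun n _ => (hB n).le⟩
  obtain ⟨N, hN⟩ := Nat.find_spec hex
  refine ⟨Nat.find hex, N, hN, ?_⟩
  by_contra hcon
  simp only [InfOften, not_forall, not_exists, not_and] at hcon
  obtain ⟨M, hM⟩ := hcon
  have hlt : ∀ n, max M N ≤ n → c n < Nat.find hex := fun n hn =>
    lt_of_le_of_ne (hN n (le_trans (le_max_right _ _) hn))
      (hM n (le_trans (le_max_left _ _) hn))
  have hpos := hlt _ le_rfl
  have := Nat.find_min' hex (m := Nat.find hex - 1)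
    ⟨max M N, fun n hn => by have := hlt n hn; omega⟩
  omega

lemma parityAcc_succ {c : ℕ → ℕ} {B : ℕ} (hB : ∀ n, c n < B) :
    ParityAcc (fun n => c n + 1) ↔ ¬ ParityAcc c := by
  obtain ⟨p, N, hle, hp⟩ := exists_limsup_priority hB
  rw [parityAcc_iff_even hle hp, parityAcc_iff_even (p := p + 1) (N := N)
    (fun n hn => by have := hle n hn; omega)
    (fun M => (hp M).imp fun n hn => ⟨hn.1, by simp [hn.2]⟩), Nat.even_add_one]

end Parity

/-- Concatenating nonempty finite paths yields an infinite path. -/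
lemma exists_path_through {S : Type} {E : S → S → Prop} (z : ℕ → S)
    (hz : ∀ i, Relation.TransGen E (z i) (z (i + 1))) :
    ∃ (y : ℕ → S) (φ : ℕ → ℕ), y 0 = z 0 ∧ (∀ n, E (y n) (y (n + 1))) ∧ StrictMono φ ∧
      ∀ i, y (φ i) = z i := by
  have hpath : ∀ a b, Relation.TransGen E a b → ∃ (k : ℕ) (g : ℕ → S), 0 < k ∧ g 0 = a ∧
      g k = b ∧ ∀ i < k, E (g i) (g (i + 1)) := by
    intro a b hab
    induction hab using Relation.TransGen.head_induction_on with
    | single h =>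
      rename_i a
      exact ⟨1, fun i => if i = 0 then a else b, by simp, by simp, by simp,
        fun i hi => by obtain rfl : i = 0 := by omega
                       simpa using h⟩
    | head h _ ih =>
      rename_i a c _
      obtain ⟨k, g, hk, h0, h1, hg⟩ := ih
      refine ⟨k + 1, fun i => Nat.casesOn i a g, by omega, rfl, h1, ?_⟩
      rintro (_ | i) hi
      · simpa [h0] using h
      · exact hg i (by omega)
  choose k g hk h0 h1 hg using fun i => hpath _ _ (hz i)
  let next : ℕ × ℕ → ℕ × ℕ := fun s => if s.2 + 1 < k s.1 then (s.1, s.2 + 1) else (s.1 + 1, 0)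
  let st : ℕ → ℕ × ℕ := fun n => next^[n] (0, 0)
  have hst : ∀ n, st (n + 1) = next (st n) := fun n => Function.iterate_succ_apply' _ _ _
  have hlt : ∀ n, (st n).2 < k (st n).1 := by
    intro n
    induction n with
    | zero => exact hk 0
    | succ n ih =>
      rw [hst]
      by_cases h : (st n).2 + 1 < k (st n).1
      · simp [next, h]
      · simp [next, h, hk]
  have hrun : ∀ n i, st n = (i, 0) → ∀ j, j < k i → st (n + j) = (i, j) := by
    intro n i hn j
    induction j with
    | zero => intro _; exact hn
    | succ j ih =>
      intro hj
      rw [← add_assoc, hst, ih (by omega)]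
      simp [next, hj]
  have hblock : ∀ n i, st n = (i, 0) → st (n + k i) = (i + 1, 0) := by
    intro n i hn
    have hk' := hk i
    have := hrun n i hn (k i - 1) (by omega)
    rw [show n + k i = n + (k i - 1) + 1 by omega, hst, this]
    simp [next, show ¬ (k i - 1 + 1 < k i) by omega]
  have hφ : ∀ i, st (∑ j ∈ Finset.range i, k j) = (i, 0) := by
    intro i
    induction i with
    | zero => rfl
    | succ i ih => rw [Finset.sum_range_succ]; exact hblock _ _ ih
  refine ⟨fun n => g (st n).1 (st n).2, fun i => ∑ j ∈ Finset.range i, k j, h0 0, fun n => ?_,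
    strictMono_nat_of_lt_succ fun i => ?_, fun i => ?_⟩
  · have hn := hlt n
    have := hg _ _ hn
    simp only [hst]
    by_cases h : (st n).2 + 1 < k (st n).1
    · simpa [next, h] using this
    · have he : (st n).2 + 1 = k (st n).1 := by omega
      rw [he, h1] at this
      simpa [next, h, h0] using this
  · rw [Finset.sum_range_succ]
    have := hk i
    omega
  · simp [hφ, h0]

end GFGPaper

namespace GFGPaper

section Threads

/-- The partial action of a finite word on positions, given the action of letters. -/
def runWord {A X : Type} (act : A → X → Option X) : List A → X → Option X
  | [], x => some x
  | a :: v, x => (act a x).bind (runWord act v)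

/-- The word carries an infinite thread: a position that survives forever from some time on. -/
def HasThread {A X : Type} (act : A → X → Option X) (w : ℕ → A) : Prop :=
  ∃ (T : ℕ) (x : ℕ → X), ∀ n, act (w (T + n)) (x n) = some (x (n + 1))

variable {A X : Type} {act : A → X → Option X}

lemma runWord_append (u v : List A) (x : X) :
    runWord act (u ++ v) x = (runWord act u x).bind (runWord act v) := by
  induction u generalizing x with
  | nil => rfl
  | cons a u ih =>
    simp only [List.cons_append, runWord]
    cases act a x with
    | none => rfl
    | some y => exact ih y

lemma runWord_singleton (a : A) (x : X) : runWord act [a] x = act a x := by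
  simp only [runWord]
  cases act a x <;> rfl

lemma runWord_inj (hinj : ∀ a x x' y, act a x = some y → act a x' = some y → x = x')
    (v : List A) : ∀ x x' y, runWord act v x = some y → runWord act v x' = some y → x = x' := by
  induction v with
  | nil => intro x x' y h h'; simp [runWord] at h h'; rw [h, h']
  | cons a v ih =>
    intro x x' y h h'
    simp only [runWord, Option.bind_eq_some_iff] at h h'
    obtain ⟨z, hz, h⟩ := h
    obtain ⟨z', hz', h'⟩ := h'
    obtain rfl := ih _ _ _ h h'
    exact hinj _ _ _ _ hz hz'

lemma pref_succ (w : ℕ → A) (n : ℕ) : pref w (n + 1) = pref w n ++ [w n] := by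
  unfold pref
  rw [List.ofFn_succ']
  simp [List.concat_eq_append]

lemma pref_length (w : ℕ → A) (n : ℕ) : (pref w n).length = n := by simp [pref]

lemma pref_add (w : ℕ → A) (n k : ℕ) :
    pref w (n + k) = pref w n ++ pref (fun i => w (n + i)) k := by
  induction k with
  | zero => simp [pref]
  | succ k ih => rw [← add_assoc, pref_succ, pref_succ, ih, List.append_assoc]

/-- Along a thread, the word acts as the thread prescribes. -/
lemma runWord_pref_of_thread {w : ℕ → A} {x : ℕ → X} (hx : ∀ n, act (w n) (x n) = some (x (n + 1)))
    (n : ℕ) : runWord act (pref w n) (x 0) = some (x n) := by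
  induction n with
  | zero => rfl
  | succ n ih => rw [pref_succ, runWord_append, ih]; simp [runWord_singleton, hx]

lemma HasThread.of_shift {w : ℕ → A} (k : ℕ) (h : HasThread act fun n => w (k + n)) :
    HasThread act w := by
  obtain ⟨T, x, hx⟩ := h
  exact ⟨k + T, x, fun n => by simpa [add_assoc] using hx n⟩

lemma HasThread.shift {w : ℕ → A} (k : ℕ) (h : HasThread act w) :
    HasThread act fun n => w (k + n) := by
  obtain ⟨T, x, hx⟩ := h
  exact ⟨T, fun n => x (n + k), fun n => by
    have := hx (n + k)
    rw [show T + (n + k) = k + (T + n) by omega] at this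
    rw [this, show n + k + 1 = n + 1 + k by omega]⟩

lemma not_hasThread_of_killing {w : ℕ → A}
    (h : ∀ N, ∃ n k, N ≤ n ∧ ∀ x, runWord act (pref (fun i => w (n + i)) k) x = none) :
    ¬ HasThread act w := by
  rintro ⟨T, x, hx⟩
  obtain ⟨n, k, hn, hk⟩ := h T
  have := runWord_pref_of_thread (act := act) (w := fun i => w (n + i)) (x := fun i => x (n - T + i))
    (fun i => by
      have := hx (n - T + i)
      rwa [show T + (n - T + i) = n + i by omega] at this) k
  rw [hk] at this
  cases this

end Threads

section OldestThread

variable {A X : Type} (act : A → X → Option X) (x₀ : X)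

lemma exists_alive_start (x₀ : X) (u : List A) : ∃ k, ∃ x, (runWord act (u.drop k) x).isSome :=
  ⟨u.length, x₀, by simp [runWord]⟩

open Classical in
/-- The earliest starting time of a thread that survives until the end of `u`. -/
noncomputable def oldestTime (u : List A) : ℕ := Nat.find (exists_alive_start act x₀ u)

open Classical in
/-- The starting position of an oldest thread alive at the end of `u`. -/
noncomputable def oldestStart (u : List A) : X :=
  (Nat.find_spec (exists_alive_start act x₀ u)).choose

/-- The end of an oldest thread alive at the end of `u`. -/
noncomputable def oldestEnd (u : List A) : X :=
  (runWord act (u.drop (oldestTime act x₀ u)) (oldestStart act x₀ u)).getD x₀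

lemma runWord_oldest (u : List A) :
    runWord act (u.drop (oldestTime act x₀ u)) (oldestStart act x₀ u) =
      some (oldestEnd act x₀ u) := by
  classical
  have h : (runWord act (u.drop (oldestTime act x₀ u)) (oldestStart act x₀ u)).isSome :=
    (Nat.find_spec (exists_alive_start act x₀ u)).choose_spec
  obtain ⟨y, hy⟩ := Option.isSome_iff_exists.1 h
  simp [oldestEnd, hy]

lemma oldestTime_le {u : List A} {k : ℕ} {x : X} (h : (runWord act (u.drop k) x).isSome) :
    oldestTime act x₀ u ≤ k := by
  classical
  exact Nat.find_min' (exists_alive_start act x₀ u) ⟨x, h⟩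

variable {act}

lemma drop_pref (w : ℕ → A) {k n : ℕ} (h : k ≤ n) :
    (pref w n).drop k = pref (fun i => w (k + i)) (n - k) := by
  obtain ⟨d, rfl⟩ := Nat.exists_eq_add_of_le h
  rw [pref_add, List.drop_append_of_le_length (by simp [pref_length])]
  simp [pref_length, List.drop_of_length_le]

/-- A run that follows threads and, when its thread dies, moves to an oldest one,
changes thread only finitely often on words carrying an infinite thread. -/
lemma oldest_run_breaks_finitely [Finite X] {w : ℕ → A} {x : ℕ → X} (N : ℕ)
    (hstep : ∀ n, N ≤ n → ∀ y, act (w n) (x n) = some y → x (n + 1) = y)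
    (hjump : ∀ n, N ≤ n → act (w n) (x n) = none → x (n + 1) = oldestEnd act x₀ (pref w (n + 1)))
    (h : HasThread act w) : ∃ M, ∀ n, M ≤ n → act (w n) (x n) ≠ none := by
  obtain ⟨T, z, hz⟩ := h
  by_contra hcon
  push Not at hcon
  set D : Set ℕ := {n | N ≤ n ∧ T ≤ n ∧ act (w n) (x n) = none} with hD
  have hDinf : D.Infinite := by
    refine Set.infinite_of_not_bddAbove ?_
    rintro ⟨b, hb⟩
    obtain ⟨n, hn, hn'⟩ := hcon (max (max N T) (b + 1))
    have := hb (show n ∈ D from ⟨by omega, by omega, hn'⟩)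
    omega
  let F : ℕ → ℕ × X := fun n =>
    (oldestTime act x₀ (pref w (n + 1)), oldestStart act x₀ (pref w (n + 1)))
  have htime : ∀ n ∈ D, oldestTime act x₀ (pref w (n + 1)) ≤ T := by
    rintro n ⟨-, hT, -⟩
    refine oldestTime_le act x₀ (x := z 0) ?_
    rw [drop_pref w (by omega),
      runWord_pref_of_thread (act := act) (w := fun i => w (T + i)) (x := z) hz]
    rfl
  have hmaps : Set.MapsTo F D (Set.Iic T ×ˢ Set.univ) := fun n hn => ⟨htime n hn, trivial⟩
  have hinj : Set.InjOn F D := by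
    have key : ∀ n ∈ D, ∀ m ∈ D, n < m → F n ≠ F m := by
      intro n hn m hm hnm hF
      obtain ⟨hFt, hFs⟩ := Prod.mk.inj hF
      set k := oldestTime act x₀ (pref w (n + 1)) with hk
      have hkT := htime n hn
      have hkn : k ≤ n + 1 := by have := hn.2.1; omega
      have hval : ∀ j, n + 1 ≤ j →
          runWord act (pref (fun i => w (k + i)) (j - k)) (oldestStart act x₀ (pref w (n + 1))) =
            some (x j) ∨
          runWord act (pref (fun i => w (k + i)) (j - k)) (oldestStart act x₀ (pref w (n + 1))) =
            none := by
        intro j hj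
        induction j, hj using Nat.le_induction with
        | base =>
          left
          rw [← drop_pref w hkn, runWord_oldest, hjump n hn.1 hn.2.2]
        | succ j hj ih =>
          rw [show j + 1 - k = (j - k) + 1 by omega, pref_succ, runWord_append]
          rcases ih with ih | ih
          · rw [ih]
            simp only [Option.bind_some, runWord_singleton]
            rw [show k + (j - k) = j by omega]
            cases hc : act (w j) (x j) with
            | none => right; rfl
            | some y => left; rw [hstep j (by have := hn.1; omega) y hc]
          · right; rw [ih]; rfl
      have h1 := hval m (by omega)
      have h2 := runWord_oldest act x₀ (pref w (m + 1))
      rw [← hFt, ← hFs, drop_pref w (by omega), show m + 1 - k = (m - k) + 1 by omega,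
        pref_succ, runWord_append] at h2
      rcases h1 with h1 | h1
      · rw [h1] at h2
        simp only [Option.bind_some, runWord_singleton] at h2
        rw [show k + (m - k) = m by omega, hm.2.2] at h2
        cases h2
      · rw [h1] at h2
        cases h2
    intro n hn m hm hF
    rcases lt_trichotomy n m with h | h | h
    · exact absurd hF (key n hn m hm h)
    · exact h
    · exact absurd hF.symm (key m hm n hn h)
  exact hDinf (Set.Finite.of_injOn hmaps hinj ((Set.finite_Iic T).prod Set.finite_univ))

/-- A run that follows threads and changes thread finitely often witnesses a thread. -/
lemma hasThread_of_run {w : ℕ → A} {x : ℕ → X} (N : ℕ)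
    (hstep : ∀ n, N ≤ n → ∀ y, act (w n) (x n) = some y → x (n + 1) = y)
    (halive : ∀ n, N ≤ n → act (w n) (x n) ≠ none) : HasThread act w := by
  refine ⟨N, fun n => x (N + n), fun n => ?_⟩
  obtain ⟨y, hy⟩ := Option.ne_none_iff_exists'.1 (halive (N + n) (by omega))
  rw [hy, ← hstep (N + n) (by omega) y hy, add_assoc]

end OldestThread

end GFGPaper

namespace GFGPaper

section LowerBound

variable {A X P : Type} (act : A → X → Option X) (prio : P → A → P → ℕ)
  (f : List A → P) (m : ℕ) (C : Set (List A))

/-- Letter `a` keeps alive at least `m` of the positions in `S`. -/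
def Keeps (S : Finset X) (a : A) : Prop := m ≤ (S.filter fun x => (act a x).isSome).card

/-- A family of histories closed under all letters that keep enough of the positions
marked by `Z` alive; marks follow threads, and all priorities seen are below `c`. -/
structure IsRegion (c : ℕ) (H : Set (List A)) (Z : P → Finset X) : Prop where
  nonempty : H.Nonempty
  sub : H ⊆ C
  large : ∀ h ∈ H, m ≤ (Z (f h)).card
  closed : ∀ h ∈ H, ∀ a, Keeps act m (Z (f h)) a → h ++ [a] ∈ H
  prio_lt : ∀ h ∈ H, ∀ a, Keeps act m (Z (f h)) a → prio (f h) a (f (h ++ [a])) < c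
  marks : ∀ h ∈ H, ∀ a, Keeps act m (Z (f h)) a → ∀ x ∈ Z (f h), ∀ y, act a x = some y →
    y ∈ Z (f (h ++ [a]))

/-- One step of a history, labelled with the priority seen, in a region. -/
def RegionStep (H : Set (List A)) (Z : P → Finset X) (s t : List A × ℕ) : Prop :=
  s.1 ∈ H ∧ ∃ a, Keeps act m (Z (f s.1)) a ∧ t = (s.1 ++ [a], prio (f s.1) a (f (s.1 ++ [a])))

/-- One step of a marked position, along some history of the region. -/
def MarkStep (H : Set (List A)) (Z : P → Finset X) (s t : (P × X) × ℕ) : Prop :=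
  ∃ h ∈ H, ∃ a, Keeps act m (Z (f h)) a ∧ s.1.1 = f h ∧ s.1.2 ∈ Z (f h) ∧
    act a s.1.2 = some t.1.2 ∧ t.1.1 = f (h ++ [a]) ∧ t.2 = prio (f h) a (f (h ++ [a]))

variable {act prio f m C} {c : ℕ} {H : Set (List A)} {Z : P → Finset X}

lemma Keeps.of_subset {S K : Finset X} {a : A} (hK : K ⊆ S) (hm : m ≤ K.card)
    (ha : ∀ x ∈ K, (act a x).isSome) : Keeps act m S a :=
  hm.trans (Finset.card_le_card fun x hx => Finset.mem_filter.2 ⟨hK hx, ha x hx⟩)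

lemma exists_image_of_isSome (g : X → Option X)
    (hinj : ∀ x x' y, g x = some y → g x' = some y → x = x') (K : Finset X)
    (hK : ∀ x ∈ K, (g x).isSome) :
    ∃ L : Finset X, L.card = K.card ∧ (∀ y ∈ L, ∃ x ∈ K, g x = some y) ∧
      ∀ x ∈ K, ∀ y, g x = some y → y ∈ L := by
  classical
  refine ⟨K.image fun x => (g x).getD x, Finset.card_image_of_injOn ?_, ?_, ?_⟩
  · intro x hx x' hx' hxx
    obtain ⟨y, hy⟩ := Option.isSome_iff_exists.1 (hK x hx)
    obtain ⟨y', hy'⟩ := Option.isSome_iff_exists.1 (hK x' hx')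
    simp only [hy, hy', Option.getD_some] at hxx
    subst hxx
    exact hinj _ _ _ hy hy'
  · intro y hy
    obtain ⟨x, hx, rfl⟩ := Finset.mem_image.1 hy
    obtain ⟨z, hz⟩ := Option.isSome_iff_exists.1 (hK x hx)
    exact ⟨x, hx, by simp [hz]⟩
  · intro x hx y hy
    exact Finset.mem_image.2 ⟨x, hx, by simp [hy]⟩



lemma IsRegion.extend (hR : IsRegion act prio f m C c H Z)
    (hinj : ∀ a x x' y, act a x = some y → act a x' = some y → x = x') (v : List A) :
    ∀ h ∈ H, ∀ K ⊆ Z (f h), m ≤ K.card → (∀ x ∈ K, (runWord act v x).isSome) →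
      h ++ v ∈ H ∧ (∀ x ∈ K, ∀ y, runWord act v x = some y → y ∈ Z (f (h ++ v))) ∧
      ∀ i, ∃ j, Relation.ReflTransGen (RegionStep act prio f m H Z) (h, i) (h ++ v, j) := by
  induction v with
  | nil =>
    intro h hh K hK _ _
    refine ⟨by simpa, fun x hx y hy => ?_, fun i => ⟨i, by simpa using .refl⟩⟩
    simp only [runWord, Option.some.injEq] at hy
    simpa [← hy] using hK hx
  | cons a v ih =>
    intro h hh K hK hm hv
    have ha : ∀ x ∈ K, (act a x).isSome := by
      intro x hx
      have := hv x hx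
      simp only [runWord] at this
      cases hc : act a x with
      | none => simp [hc] at this
      | some y => rfl
    have hkeep : Keeps act m (Z (f h)) a := .of_subset hK hm ha
    obtain ⟨L, hL, hLK, hKL⟩ := exists_image_of_isSome (act a) (hinj a) K ha
    have hLZ : L ⊆ Z (f (h ++ [a])) := by
      intro y hy
      obtain ⟨x, hx, hxy⟩ := hLK y hy
      exact hR.marks h hh a hkeep x (hK hx) y hxy
    have := ih (h ++ [a]) (hR.closed h hh a hkeep) L hLZ (hL ▸ hm) (by
      intro y hy
      obtain ⟨x, hx, hxy⟩ := hLK y hy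
      simpa [runWord, hxy] using hv x hx)
    rw [List.append_assoc, List.singleton_append] at this
    obtain ⟨h1, h2, h3⟩ := this
    refine ⟨h1, fun x hx y hy => ?_, fun i => ?_⟩
    · simp only [runWord, Option.bind_eq_some_iff] at hy
      obtain ⟨z, hz, hy⟩ := hy
      exact h2 z (hKL x hx z hz) y hy
    · obtain ⟨j, hj⟩ := h3 (prio (f h) a (f (h ++ [a])))
      exact ⟨j, .head ⟨hh, a, hkeep, rfl⟩ hj⟩

lemma IsRegion.mem_of_reflTransGen (hR : IsRegion act prio f m C c H Z) {s t : List A × ℕ}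
    (h : Relation.ReflTransGen (RegionStep act prio f m H Z) s t) (hs : s.1 ∈ H) :
    t.1 ∈ H ∧ ∃ v, t.1 = s.1 ++ v := by
  induction h with
  | refl => exact ⟨hs, [], by simp⟩
  | tail _ hst ih =>
    obtain ⟨hH, a, ha, rfl⟩ := hst
    obtain ⟨-, v, hv⟩ := ih
    exact ⟨hR.closed _ hH a ha, v ++ [a], by simp [hv]⟩

/-- If the top priority is odd, restricting the marks to positions from which few more
visits to it are possible yields a region without that priority. -/
lemma IsRegion.lower_of_odd (hR : IsRegion act prio f m C (c + 1) H Z) (hc : ¬ Even c) (hm : 0 < m)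
    (hinj : ∀ a x x' y, act a x = some y → act a x' = some y → x = x')
    (haccept : ∀ (q : ℕ → P) (w : ℕ → A) (g : ℕ → List A),
      (∀ n, g n ∈ C ∧ f (g n) = q n ∧ f (g n ++ [w n]) = q (n + 1)) → HasThread act w →
      ParityAcc fun n => prio (q n) (w n) (q (n + 1))) :
    ∃ H' Z', IsRegion act prio f m C c H' Z' := by
  classical
  let E := MarkStep act prio f m H Z
  let R : (P × X) × ℕ → (P × X) × ℕ → Prop := fun t s => Relation.TransGen E s t ∧ t.2 = c
  have hwf : WellFounded R := by
    rw [wellFounded_iff_isEmpty_descending_chain]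
    refine ⟨fun ⟨z, hz⟩ => ?_⟩
    obtain ⟨y, φ, -, hE, hφ, hyφ⟩ := exists_path_through z fun i => (hz i).1
    choose g hgH w hkeep hq hx hact hq' hp using hE
    have hpc : ∀ n, prio (y n).1.1 (w n) (y (n + 1)).1.1 = (y (n + 1)).2 := fun n => by
      rw [hq, hq', hp]
    refine hc ((parityAcc_iff_even (N := 0) (fun n _ => ?_) fun N => ?_).1
      (haccept (fun n => (y n).1.1) w g
        (fun n => ⟨hR.sub (hgH n), (hq n).symm, (hq' n).symm⟩)
        ⟨0, fun n => (y n).1.2, fun n => by simpa using hact n⟩))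
    · rw [hpc, hp]
      exact Nat.lt_succ_iff.1 (hR.prio_lt _ (hgH n) _ (hkeep n))
    · have h1 : N + 1 ≤ φ (N + 1) := hφ.le_apply
      refine ⟨φ (N + 1) - 1, by omega, ?_⟩
      beta_reduce
      rw [hpc, Nat.sub_add_cancel (by omega), hyφ]
      exact (hz N).2
  have : IsWellFounded _ R := ⟨hwf⟩
  let r : P × X → Ordinal := fun s => IsWellFounded.rank R (s, 0)
  have hmono : ∀ s t : (P × X) × ℕ, (∀ u, R u s → R u t) →
      IsWellFounded.rank R s ≤ IsWellFounded.rank R t := by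
    intro s t hst
    rw [IsWellFounded.rank_eq]
    exact Ordinal.iSup_le fun u => Order.succ_le_of_lt (IsWellFounded.rank_lt_of_rel (hst _ u.2))
  have hr_le : ∀ s t i, E (s, 0) (t, i) → r t ≤ r s := by
    intro s t i hst
    refine hmono _ _ fun u hu => ⟨?_, hu.2⟩
    obtain ⟨b, hb, hbu⟩ := Relation.TransGen.head'_iff.1 hu.1
    exact .head hst (.head' (show E (t, i) b from hb) hbu)
  have hr_lt : ∀ s t, E (s, 0) (t, c) → r t < r s := by
    intro s t hst
    refine lt_of_le_of_lt (hmono _ (t, c) fun u hu => ⟨?_, hu.2⟩)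
      (IsWellFounded.rank_lt_of_rel (r := R) ⟨.single hst, rfl⟩)
    obtain ⟨b, hb, hbu⟩ := Relation.TransGen.head'_iff.1 hu.1
    exact .head' (show E (t, c) b from hb) hbu
  let Zr : Ordinal → P → Finset X := fun i q => (Z q).filter fun x => r (q, x) ≤ i
  have hex : ∃ i, ∃ h ∈ H, m ≤ (Zr i (f h)).card := by
    obtain ⟨h, hh⟩ := hR.nonempty
    refine ⟨(Z (f h)).sup fun x => r (f h, x), h, hh, (hR.large h hh).trans ?_⟩
    exact Finset.card_le_card fun x hx =>
      Finset.mem_filter.2 ⟨hx, Finset.le_sup (f := fun x => r (f h, x)) hx⟩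
  obtain ⟨i, ⟨h₀, hh₀, hm₀⟩, hmin⟩ := Ordinal.lt_wf.has_min {i | ∃ h ∈ H, m ≤ (Zr i (f h)).card} hex
  have hsub : ∀ q, Zr i q ⊆ Z q := fun q => Finset.filter_subset _ _
  have hkeep : ∀ h a, Keeps act m (Zr i (f h)) a → Keeps act m (Z (f h)) a := fun h a hk =>
    hk.trans (Finset.card_le_card (Finset.filter_subset_filter _ (hsub _)))
  have hedge : ∀ h ∈ H, ∀ a, Keeps act m (Z (f h)) a → ∀ x ∈ Z (f h), ∀ y, act a x = some y →
      E ((f h, x), 0) ((f (h ++ [a]), y), prio (f h) a (f (h ++ [a]))) :=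
    fun h hh a hk x hx y hxy => ⟨h, hh, a, hk, rfl, hx, hxy, rfl, rfl⟩
  have hmarks : ∀ h ∈ H, ∀ a, Keeps act m (Zr i (f h)) a → ∀ x ∈ Zr i (f h), ∀ y,
      act a x = some y → y ∈ Zr i (f (h ++ [a])) := by
    intro h hh a hk x hx y hxy
    have hx' := Finset.mem_filter.1 hx
    exact Finset.mem_filter.2 ⟨hR.marks h hh a (hkeep h a hk) x hx'.1 y hxy,
      (hr_le _ _ _ (hedge h hh a (hkeep h a hk) x hx'.1 y hxy)).trans hx'.2⟩
  have himage : ∀ h a, Keeps act m (Zr i (f h)) a → ∃ L : Finset X, m ≤ L.card ∧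
      ∀ y ∈ L, ∃ x ∈ Zr i (f h), act a x = some y := by
    intro h a hk
    obtain ⟨L, hL, hLK, -⟩ := exists_image_of_isSome (act a) (hinj a)
      ((Zr i (f h)).filter fun x => (act a x).isSome) fun x hx => (Finset.mem_filter.1 hx).2
    refine ⟨L, hL ▸ hk, fun y hy => ?_⟩
    obtain ⟨x, hx, hxy⟩ := hLK y hy
    exact ⟨x, (Finset.mem_filter.1 hx).1, hxy⟩
  refine ⟨{h | h ∈ H ∧ m ≤ (Zr i (f h)).card}, Zr i, ⟨⟨h₀, hh₀, hm₀⟩, fun h hh => hR.sub hh.1,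
    fun h hh => hh.2, fun h hh a hk => ?_, fun h hh a hk => ?_, fun h hh => hmarks h hh.1⟩⟩
  · obtain ⟨L, hL, hLZ⟩ := himage h a hk
    refine ⟨hR.closed h hh.1 a (hkeep h a hk), hL.trans (Finset.card_le_card fun y hy => ?_)⟩
    obtain ⟨x, hx, hxy⟩ := hLZ y hy
    exact hmarks h hh.1 a hk x hx y hxy
  · refine lt_of_le_of_ne (Nat.lt_succ_iff.1 (hR.prio_lt h hh.1 a (hkeep h a hk))) fun hpc => ?_
    obtain ⟨L, hL, hLZ⟩ := himage h a hk
    obtain ⟨y₀, hy₀, hmax⟩ := Finset.exists_max_image L (fun y => r (f (h ++ [a]), y))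
      (Finset.card_pos.1 (hm.trans_le hL))
    have hdrop : ∀ y ∈ L, r (f (h ++ [a]), y) < i := by
      intro y hy
      obtain ⟨x, hx, hxy⟩ := hLZ y hy
      have hx' := Finset.mem_filter.1 hx
      refine (hr_lt _ _ ?_).trans_le hx'.2
      simpa [hpc] using hedge h hh.1 a (hkeep h a hk) x hx'.1 y hxy
    refine hmin _ ⟨h ++ [a], hR.closed h hh.1 a (hkeep h a hk),
      hL.trans (Finset.card_le_card fun y hy => ?_)⟩ (hdrop y₀ hy₀)
    obtain ⟨x, hx, hxy⟩ := hLZ y hy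
    exact Finset.mem_filter.2
      ⟨(Finset.mem_filter.1 (hmarks h hh.1 a hk x hx y hxy)).1, hmax y hy⟩

end LowerBound

end GFGPaper

namespace GFGPaper

section LowerBound

variable {A X P : Type} {act : A → X → Option X} {prio : P → A → P → ℕ}
  {f : List A → P} {m : ℕ} {C : Set (List A)} {c : ℕ} {H : Set (List A)} {Z : P → Finset X}

lemma two_pow_le_choose {m s : ℕ} (h₁ : m ≤ s) (h₂ : s ≤ 2 * m) : 2 ^ m ≤ (3 * m).choose s := by
  rw [show 3 * m = m + 2 * m by ring, Nat.add_choose_eq,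
    Finset.Nat.sum_antidiagonal_eq_sum_range_succ fun i j => m.choose i * (2 * m).choose j,
    ← Nat.sum_range_choose]
  calc ∑ i ∈ Finset.range (m + 1), m.choose i
      ≤ ∑ i ∈ Finset.range (m + 1), m.choose i * (2 * m).choose (s - i) :=
        Finset.sum_le_sum fun i _ => Nat.le_mul_of_pos_right _ (Nat.choose_pos (by omega))
    _ ≤ _ := Finset.sum_le_sum_of_subset (Finset.range_subset_range.2 (by omega))

/-- If no history reachable from `h₀` takes a step with the top priority, then that priority
can be dropped. -/
lemma IsRegion.lower_of_unreachable (hR : IsRegion act prio f m C (c + 1) H Z) {h₀ : List A}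
    {i : ℕ} (hh₀ : h₀ ∈ H)
    (hno : ∀ t, Relation.ReflTransGen (RegionStep act prio f m H Z) (h₀, i) t →
      ∀ a, Keeps act m (Z (f t.1)) a → prio (f t.1) a (f (t.1 ++ [a])) ≠ c) :
    ∃ H', IsRegion act prio f m C c H' Z := by
  have hmem : ∀ h j, Relation.ReflTransGen (RegionStep act prio f m H Z) (h₀, i) (h, j) → h ∈ H :=
    fun h j hj => (hR.mem_of_reflTransGen hj hh₀).1
  refine ⟨{h | ∃ j, Relation.ReflTransGen (RegionStep act prio f m H Z) (h₀, i) (h, j)},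
    ⟨h₀, i, .refl⟩, ?_, ?_, ?_, ?_, ?_⟩
  · rintro h ⟨j, hj⟩
    exact hR.sub (hmem h j hj)
  · rintro h ⟨j, hj⟩
    exact hR.large h (hmem h j hj)
  · rintro h ⟨j, hj⟩ a ha
    exact ⟨_, hj.tail ⟨hmem h j hj, a, ha, rfl⟩⟩
  · rintro h ⟨j, hj⟩ a ha
    exact lt_of_le_of_ne (Nat.lt_succ_iff.1 (hR.prio_lt h (hmem h j hj) a ha)) (hno _ hj a ha)
  · rintro h ⟨j, hj⟩
    exact hR.marks h (hmem h j hj)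

/-- If the number of marks stays bounded while some positions are preserved, then permuting the
marks of a maximal configuration yields many states. -/
lemma IsRegion.two_pow_le_card [Fintype X] [Fintype P] (hR : IsRegion act prio f m C c H Z)
    (hinj : ∀ a x x' y, act a x = some y → act a x' = some y → x = x')
    (hX : Fintype.card X = 3 * m)
    (hperm : ∀ σ : Equiv.Perm X, ∃ v, ∀ x, runWord act v x = some (σ x))
    {h : List A} (hh : h ∈ H) {K : Finset X} (hK : K ⊆ Z (f h)) (hm : m ≤ K.card)
    (hsmall : ∀ v, (∀ x ∈ K, (runWord act v x).isSome) → (Z (f (h ++ v))).card < 2 * m) :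
    2 ^ m ≤ Fintype.card P := by
  classical
  obtain ⟨v, hv, hmax⟩ : ∃ v, (∀ x ∈ K, (runWord act v x).isSome) ∧
      ∀ v', (∀ x ∈ K, (runWord act v' x).isSome) →
        (Z (f (h ++ v'))).card ≤ (Z (f (h ++ v))).card := by
    let S : Set ℕ := {k | ∃ v, (∀ x ∈ K, (runWord act v x).isSome) ∧ (Z (f (h ++ v))).card = k}
    have hS : S.Nonempty := ⟨_, [], by simp [runWord], rfl⟩
    have hb : BddAbove S := ⟨2 * m, by rintro k ⟨v, hv, rfl⟩; exact (hsmall v hv).le⟩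
    obtain ⟨v, hv, hk⟩ := Nat.sSup_mem hS hb
    exact ⟨v, hv, fun v' hv' => hk ▸ le_csSup hb ⟨v', hv', rfl⟩⟩
  have hhv := (hR.extend hinj v h hh K hK hm hv).1
  have hall : Finset.powersetCard (Z (f (h ++ v))).card Finset.univ ⊆
      Finset.univ.image Z := by
    intro T hT
    have hT := (Finset.mem_powersetCard.1 hT).2
    let σ : Equiv.Perm X := (Finset.equivOfCardEq hT.symm).extendSubtype
    obtain ⟨u, hu⟩ := hperm σ
    have hsub : T ⊆ Z (f (h ++ v ++ u)) := by
      intro y hy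
      have hx : σ.symm y ∈ Z (f (h ++ v)) := by
        by_contra hx
        exact Equiv.extendSubtype_not_mem (Finset.equivOfCardEq hT.symm) _ hx
          (by simpa [σ] using hy)
      exact (hR.extend hinj u _ hhv _ subset_rfl (hR.large _ hhv) (by simp [hu])).2.1 _ hx _
        (by simp [hu])
    refine Finset.mem_image.2 ⟨_, Finset.mem_univ _, (Finset.eq_of_subset_of_card_le hsub ?_).symm⟩
    rw [hT, List.append_assoc]
    refine hmax _ fun x hx => ?_
    obtain ⟨y, hy⟩ := Option.isSome_iff_exists.1 (hv x hx)
    simp [runWord_append, hy, hu]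
  calc 2 ^ m ≤ (3 * m).choose (Z (f (h ++ v))).card :=
        two_pow_le_choose (hR.large _ hhv) (hsmall v hv).le
    _ = _ := by rw [← hX, ← Finset.card_univ, ← Finset.card_powersetCard]
    _ ≤ _ := Finset.card_le_card hall
    _ ≤ _ := Finset.card_image_le

/-- If marks can always be doubled and the top priority can always be reached, then from each
history one can kill every position and then see the top priority. -/
lemma IsRegion.exists_killing_step (hR : IsRegion act prio f m C c H Z)
    (hinj : ∀ a x x' y, act a x = some y → act a x' = some y → x = x')
    (hkill : ∀ D : Finset X, ∃ v, ∀ x, (x ∈ D → runWord act v x = some x) ∧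
      (x ∉ D → runWord act v x = none))
    (hlarge : ∀ h ∈ H, ∀ K ⊆ Z (f h), m ≤ K.card → ∃ v,
      (∀ x ∈ K, (runWord act v x).isSome) ∧ 2 * m ≤ (Z (f (h ++ v))).card) {p : ℕ}
    (hreach : ∀ h ∈ H, ∀ i, ∃ t, Relation.ReflTransGen (RegionStep act prio f m H Z) (h, i) t ∧
      ∃ a, Keeps act m (Z (f t.1)) a ∧ prio (f t.1) a (f (t.1 ++ [a])) = p)
    {h : List A} (hh : h ∈ H) (i : ℕ) :
    ∃ u, h ++ u ∈ H ∧ (∀ x, runWord act u x = none) ∧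
      Relation.TransGen (RegionStep act prio f m H Z) (h, i) (h ++ u, p) := by
  classical
  obtain ⟨K, hK, hKm⟩ := Finset.exists_subset_card_eq (hR.large h hh)
  obtain ⟨u₁, hu₁⟩ := hkill K
  obtain ⟨hh₁, hmark₁, hstep₁⟩ := hR.extend hinj u₁ h hh K hK hKm.ge
    fun x hx => by simp [(hu₁ x).1 hx]
  obtain ⟨v, hv, hvm⟩ := hlarge _ hh₁ K (fun x hx => hmark₁ x hx x ((hu₁ x).1 hx)) hKm.ge
  obtain ⟨hh₂, -, hstep₂⟩ := hR.extend hinj v _ hh₁ K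
    (fun x hx => hmark₁ x hx x ((hu₁ x).1 hx)) hKm.ge hv
  obtain ⟨L, hL, -, hKL⟩ := exists_image_of_isSome (runWord act v) (runWord_inj hinj v) K hv
  obtain ⟨u₂, hu₂⟩ := hkill (Z (f (h ++ u₁ ++ v)) \ L)
  obtain ⟨hh₃, -, hstep₃⟩ := hR.extend hinj u₂ _ hh₂ _ (Finset.sdiff_subset (t := L))
    (by have := Finset.le_card_sdiff L (Z (f (h ++ u₁ ++ v))); omega)
    fun x hx => by simp [(hu₂ x).1 hx]
  obtain ⟨j₁, hj₁⟩ := hstep₁ i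
  obtain ⟨j₂, hj₂⟩ := hstep₂ j₁
  obtain ⟨j₃, hj₃⟩ := hstep₃ j₂
  obtain ⟨t, ht, a, ha, hp⟩ := hreach _ hh₃ j₃
  obtain ⟨hht, w, hw⟩ := hR.mem_of_reflTransGen ht hh₃
  have heq : h ++ (u₁ ++ (v ++ (u₂ ++ (w ++ [a])))) = t.1 ++ [a] := by simp [hw]
  refine ⟨u₁ ++ (v ++ (u₂ ++ (w ++ [a]))), ?_, fun x => ?_, ?_⟩
  · rw [heq]
    exact hR.closed _ hht a ha
  · by_cases hx : x ∈ K
    · obtain ⟨y, hy⟩ := Option.isSome_iff_exists.1 (hv x hx)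
      have hy' := (hu₂ y).2 (by simp [hKL x hx y hy])
      simp [runWord_append, (hu₁ x).1 hx, hy, hy']
    · simp [runWord_append, (hu₁ x).2 hx]
  · rw [heq, ← hp]
    exact .tail' (hj₁.trans (hj₂.trans (hj₃.trans ht))) ⟨hht, a, ha, rfl⟩

/-- An infinite succession of killing steps ending with an even top priority yields an accepting
run on a word without thread. -/
lemma IsRegion.exists_accepting_of_killing (hR : IsRegion act prio f m C (c + 1) H Z)
    (hc : Even c)
    (hstep : ∀ h ∈ H, ∀ i, ∃ u, h ++ u ∈ H ∧ (∀ x, runWord act u x = none) ∧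
      Relation.TransGen (RegionStep act prio f m H Z) (h, i) (h ++ u, c)) :
    ∃ h ∈ C, ∃ w, ¬ HasThread act w ∧
      ParityAcc fun n => prio (f (h ++ pref w n)) (w n) (f (h ++ pref w (n + 1))) := by
  obtain ⟨h₀, hh₀⟩ := hR.nonempty
  choose! g hgH hgkill hgstep using hstep
  let z : ℕ → List A × ℕ := fun n =>
    n.rec (h₀, c) fun _ s => (s.1 ++ g s.1 s.2, c)
  have hz : ∀ n, (z n).1 ∈ H := fun n => by
    induction n with
    | zero => exact hh₀
    | succ n ih => exact hgH _ ih _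
  obtain ⟨y, φ, hy0, hE, hφ, hyφ⟩ := exists_path_through (E := RegionStep act prio f m H Z) z
    fun n => hgstep _ (hz n) _
  choose hyH w hkeep hyw using hE
  have hpref : ∀ n, (y n).1 = h₀ ++ pref w n := fun n => by
    induction n with
    | zero => simp [hy0, z, pref]
    | succ n ih => rw [hyw, pref_succ, ih, List.append_assoc]
  have hprio : ∀ n, prio (f (h₀ ++ pref w n)) (w n) (f (h₀ ++ pref w (n + 1))) = (y (n + 1)).2 := by
    intro n
    rw [hyw, hpref, pref_succ, List.append_assoc]
  refine ⟨h₀, hR.sub hh₀, w, not_hasThread_of_killing fun N => ?_, ?_⟩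
  · obtain ⟨k, hk⟩ := Nat.exists_eq_add_of_le (hφ.monotone (Nat.le_succ N))
    refine ⟨φ N, k, hφ.le_apply, ?_⟩
    have h1 : h₀ ++ pref w (φ N + k) = h₀ ++ pref w (φ N) ++ g (z N).1 (z N).2 := by
      rw [← hpref, ← hpref, ← hk, hyφ, hyφ]
    rw [pref_add, ← List.append_assoc, List.append_cancel_left_eq] at h1
    rw [h1]
    exact hgkill _ (hz N) _
  · refine (parityAcc_iff_even (N := 0) (fun n _ => ?_) fun N => ?_).2 hc
    · rw [hprio, hyw]
      exact Nat.lt_succ_iff.1 (hR.prio_lt _ (hyH n) _ (hkeep n))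
    · have h1 : N + 1 ≤ φ (N + 1) := hφ.le_apply
      refine ⟨φ (N + 1) - 1, by omega, ?_⟩
      beta_reduce
      rw [hprio, Nat.sub_add_cancel (by omega), hyφ]

/-- A parity-labelled deterministic run structure that accepts all words with a thread, even when
glued from different histories, and rejects all words without a thread, is large. -/
theorem two_pow_le_card_of_separating [Fintype X] [Fintype P] {B : ℕ} (hm : 0 < m)
    (hinj : ∀ a x x' y, act a x = some y → act a x' = some y → x = x')
    (hX : Fintype.card X = 3 * m)
    (hperm : ∀ σ : Equiv.Perm X, ∃ v, ∀ x, runWord act v x = some (σ x))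
    (hkill : ∀ D : Finset X, ∃ v, ∀ x, (x ∈ D → runWord act v x = some x) ∧
      (x ∉ D → runWord act v x = none))
    (htotal : ∃ a, ∀ x, (act a x).isSome)
    (hB : ∀ p a q, prio p a q < B) (hC : C.Nonempty) (hclosed : ∀ h ∈ C, ∀ a, h ++ [a] ∈ C)
    (haccept : ∀ (q : ℕ → P) (w : ℕ → A) (g : ℕ → List A),
      (∀ n, g n ∈ C ∧ f (g n) = q n ∧ f (g n ++ [w n]) = q (n + 1)) → HasThread act w →
      ParityAcc fun n => prio (q n) (w n) (q (n + 1)))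
    (hreject : ∀ h ∈ C, ∀ w, ¬ HasThread act w →
      ¬ ParityAcc fun n => prio (f (h ++ pref w n)) (w n) (f (h ++ pref w (n + 1)))) :
    2 ^ m ≤ Fintype.card P := by
  classical
  have hex : ∃ c H Z, IsRegion act prio f m C c H Z := by
    refine ⟨B, C, fun _ => Finset.univ, hC, subset_rfl, fun _ _ => ?_, fun h hh a _ => hclosed h hh a,
      fun _ _ _ _ => hB _ _ _, fun _ _ _ _ _ _ _ _ => Finset.mem_univ _⟩
    rw [Finset.card_univ, hX]
    omega
  obtain ⟨H, Z, hR⟩ := Nat.find_spec hex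
  have hmin : ∀ c' < Nat.find hex, ∀ H' Z', ¬ IsRegion act prio f m C c' H' Z' :=
    fun c' hc' H' Z' h => Nat.find_min hex hc' ⟨H', Z', h⟩
  cases hc : Nat.find hex with
  | zero =>
    rw [hc] at hR
    obtain ⟨h, hh⟩ := hR.nonempty
    obtain ⟨a, ha⟩ := htotal
    exact absurd (hR.prio_lt h hh a (.of_subset subset_rfl (hR.large h hh) fun x _ => ha x))
      (Nat.not_lt_zero _)
  | succ c =>
    rw [hc] at hR hmin
    by_cases hodd : Even c
    · by_contra hcard
      have hlarge : ∀ h ∈ H, ∀ K ⊆ Z (f h), m ≤ K.card → ∃ v,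
          (∀ x ∈ K, (runWord act v x).isSome) ∧ 2 * m ≤ (Z (f (h ++ v))).card := by
        intro h hh K hK hKm
        by_contra hno
        push Not at hno
        exact hcard (hR.two_pow_le_card hinj hX hperm hh hK hKm hno)
      have hreach : ∀ h ∈ H, ∀ i, ∃ t,
          Relation.ReflTransGen (RegionStep act prio f m H Z) (h, i) t ∧
          ∃ a, Keeps act m (Z (f t.1)) a ∧ prio (f t.1) a (f (t.1 ++ [a])) = c := by
        intro h hh i
        by_contra hno
        push Not at hno
        obtain ⟨H', hR'⟩ := hR.lower_of_unreachable hh hno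
        exact hmin c (Nat.lt_succ_self c) H' Z hR'
      obtain ⟨h, hh, w, hw, hacc⟩ := hR.exists_accepting_of_killing hodd fun h hh i =>
        hR.exists_killing_step hinj hkill hlarge hreach hh i
      exact hreject h hh w hw hacc
    · obtain ⟨H', Z', hR'⟩ := hR.lower_of_odd hodd hm hinj haccept
      exact absurd hR' (hmin c (Nat.lt_succ_self c) H' Z')

end LowerBound

end GFGPaper

namespace GFGPaper

section ConcreteAction

/-- The letters act on positions by the two standard generators of the symmetric group and by
killing the position `0`. -/
def letterAct (k : ℕ) (a : Fin 3) (x : Fin (k + 2)) : Option (Fin (k + 2)) :=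
  if a = 0 then some (finRotate _ x)
  else if a = 1 then some (Equiv.swap 0 (finRotate _ 0) x)
  else if x = 0 then none else some x

lemma letterAct_inj {k : ℕ} (a : Fin 3) (x x' y : Fin (k + 2)) (h : letterAct k a x = some y)
    (h' : letterAct k a x' = some y) : x = x' := by
  unfold letterAct at h h'
  split_ifs at h h' with h0 h1
  · exact (finRotate _).injective ((Option.some.inj h).trans (Option.some.inj h').symm)
  · exact (Equiv.swap _ _).injective ((Option.some.inj h).trans (Option.some.inj h').symm)
  · exact (Option.some.inj h).trans (Option.some.inj h').symm

lemma exists_word_of_perm {k : ℕ} (σ : Equiv.Perm (Fin (k + 2))) :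
    ∃ v, ∀ x, runWord (letterAct k) v x = some (σ x) := by
  have htop : Subgroup.closure
      {finRotate (k + 2), Equiv.swap 0 (finRotate (k + 2) 0)} = ⊤ :=
    Equiv.Perm.closure_cycle_adjacent_swap isCycle_finRotate support_finRotate 0
  have hσ : σ ∈ Submonoid.closure
      ({finRotate (k + 2), Equiv.swap 0 (finRotate (k + 2) 0)} : Set (Equiv.Perm _)) := by
    rw [← Subgroup.closure_toSubmonoid_of_finite, htop]
    trivial
  induction hσ using Submonoid.closure_induction with
  | mem τ hτ =>
    rcases hτ with rfl | rfl
    · exact ⟨[0], fun x => by simp [runWord_singleton, letterAct]⟩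
    · exact ⟨[1], fun x => by simp [runWord_singleton, letterAct]⟩
  | one => exact ⟨[], fun x => rfl⟩
  | mul τ υ _ _ hτ hυ =>
    obtain ⟨u, hu⟩ := hτ
    obtain ⟨v, hv⟩ := hυ
    exact ⟨v ++ u, fun x => by simp [runWord_append, hu, hv]⟩

lemma exists_word_killing {k : ℕ} (D : Finset (Fin (k + 2))) :
    ∃ v, ∀ x, (x ∈ D → runWord (letterAct k) v x = some x) ∧
      (x ∉ D → runWord (letterAct k) v x = none) := by
  suffices h : ∀ E : Finset (Fin (k + 2)), ∃ v, ∀ x, (x ∉ E → runWord (letterAct k) v x = some x) ∧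
      (x ∈ E → runWord (letterAct k) v x = none) by
    obtain ⟨v, hv⟩ := h Dᶜ
    exact ⟨v, fun x => ⟨fun hx => (hv x).1 (by simpa), fun hx => (hv x).2 (by simpa)⟩⟩
  intro E
  induction E using Finset.induction with
  | empty => exact ⟨[], fun x => ⟨fun _ => rfl, fun h => by simp at h⟩⟩
  | insert y E hy ih =>
    obtain ⟨v, hv⟩ := ih
    obtain ⟨u, hu⟩ := exists_word_of_perm (Equiv.swap 0 y)
    have hkill : ∀ x, runWord (letterAct k) (u ++ ([2] ++ u)) x = if x = y then none else some x := by
      intro x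
      simp only [runWord_append, hu, runWord_singleton, Option.bind_some]
      by_cases hx : x = y
      · simp [letterAct, hx]
      · have : Equiv.swap 0 y x ≠ 0 := fun h => hx (by
          rw [Equiv.swap_apply_eq_iff, Equiv.swap_apply_left] at h
          exact h)
        simp [letterAct, this, hx]
    refine ⟨v ++ (u ++ ([2] ++ u)), fun x => ?_⟩
    by_cases hx : x ∈ E
    · have : x ≠ y := fun h => hy (h ▸ hx)
      rw [runWord_append, (hv x).2 hx]
      simp [hx, this]
    · rw [runWord_append, (hv x).1 hx, Option.bind_some, hkill]
      simp [hx]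

end ConcreteAction

end GFGPaper

namespace GFGPaper

section Formulas

variable {Q : Type}

/-- The atoms occurring in a formula. -/
def PosBool.atoms : PosBool Q → Set Q
  | .atom q => {q}
  | .band φ ψ => φ.atoms ∪ ψ.atoms
  | .bor φ ψ => φ.atoms ∪ ψ.atoms

lemma EveChoice.outcome_subset {φ : PosBool Q} (e : EveChoice φ) : e.outcome ⊆ φ.atoms := by
  induction e with
  | atom q => exact subset_rfl
  | band _ _ h₁ h₂ => exact Set.union_subset_union h₁ h₂
  | borl _ h => exact h.trans Set.subset_union_left
  | borr _ h => exact h.trans Set.subset_union_right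

lemma AdamChoice.outcome_subset {φ : PosBool Q} (e : AdamChoice φ) : e.outcome ⊆ φ.atoms := by
  induction e with
  | atom q => exact subset_rfl
  | bor _ _ h₁ h₂ => exact Set.union_subset_union h₁ h₂
  | bandl _ h => exact h.trans Set.subset_union_left
  | bandr _ h => exact h.trans Set.subset_union_right

lemma exists_mem_outcome {φ : PosBool Q} (e : EveChoice φ) (t : AdamChoice φ) :
    ∃ q, q ∈ e.outcome ∧ q ∈ t.outcome := by
  induction e with
  | atom q =>
    cases t
    exact ⟨q, rfl, rfl⟩
  | band _ _ h₁ h₂ =>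
    cases t with
    | bandl t => exact (h₁ t).imp fun q h => ⟨.inl h.1, h.2⟩
    | bandr t => exact (h₂ t).imp fun q h => ⟨.inr h.1, h.2⟩
  | borl _ h =>
    cases t with
    | bor t _ => exact (h t).imp fun q h => ⟨h.1, .inl h.2⟩
  | borr _ h =>
    cases t with
    | bor _ t => exact (h t).imp fun q h => ⟨h.1, .inr h.2⟩

lemma nonempty_eveChoice (φ : PosBool Q) : Nonempty (EveChoice φ) := by
  induction φ with
  | atom q => exact ⟨.atom q⟩
  | band _ _ h₁ h₂ => exact ⟨.band h₁.some h₂.some⟩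
  | bor _ _ h _ => exact ⟨.borl h.some⟩

lemma nonempty_adamChoice (φ : PosBool Q) : Nonempty (AdamChoice φ) := by
  induction φ with
  | atom q => exact ⟨.atom q⟩
  | band _ _ h _ => exact ⟨.bandl h.some⟩
  | bor _ _ h₁ h₂ => exact ⟨.bor h₁.some h₂.some⟩

/-- The disjunction of `q` and the states in a list. -/
def bigOr (q : Q) : List Q → PosBool Q
  | [] => .atom q
  | p :: l => .bor (.atom p) (bigOr q l)

/-- The conjunction of `q` and the states in a list. -/
def bigAnd (q : Q) : List Q → PosBool Q
  | [] => .atom q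
  | p :: l => .band (.atom p) (bigAnd q l)

lemma atoms_bigOr_subset (q : Q) (l : List Q) : (bigOr q l).atoms ⊆ {p | p = q ∨ p ∈ l} := by
  induction l with
  | nil => exact fun p hp => .inl hp
  | cons p l ih =>
    rintro r (rfl | hr)
    · simp
    · rcases ih hr with h | h <;> simp [h]

lemma atoms_bigAnd_subset (q : Q) (l : List Q) : (bigAnd q l).atoms ⊆ {p | p = q ∨ p ∈ l} := by
  induction l with
  | nil => exact fun p hp => .inl hp
  | cons p l ih =>
    rintro r (rfl | hr)
    · simp
    · rcases ih hr with h | h <;> simp [h]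

lemma exists_eveChoice_bigOr (q : Q) {l : List Q} {p : Q} (hp : p ∈ l) :
    ∃ e : EveChoice (bigOr q l), e.outcome = {p} := by
  induction l with
  | nil => cases hp
  | cons r l ih =>
    rcases List.mem_cons.1 hp with rfl | hp
    · exact ⟨.borl (.atom p), rfl⟩
    · obtain ⟨e, he⟩ := ih hp
      exact ⟨.borr e, he⟩

lemma exists_adamChoice_bigAnd (q : Q) {l : List Q} {p : Q} (hp : p ∈ l) :
    ∃ e : AdamChoice (bigAnd q l), e.outcome = {p} := by
  induction l with
  | nil => cases hp
  | cons r l ih =>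
    rcases List.mem_cons.1 hp with rfl | hp
    · exact ⟨.bandl (.atom p), rfl⟩
    · obtain ⟨e, he⟩ := ih hp
      exact ⟨.bandr e, he⟩

end Formulas

section ThreadAutomaton

variable {A X : Type} [Fintype X] (act : A → X → Option X) (x₀ : X) (branch : A → Bool)

/-- All states following a thread in the given mode. -/
noncomputable def modeStates (b : Bool) : List (Option (Bool × X)) :=
  (Finset.univ : Finset X).toList.map fun y => some (b, y)

/-- The automaton whose first letter selects between the automaton guessing an infinite thread
(mode `true`) and its dual (mode `false`). -/
noncomputable def threadAut : APW A (Option (Bool × X)) where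
  init := none
  δ q a := match q with
    | none => .atom (some (branch a, x₀))
    | some (b, x) => match act a x with
      | some y => .atom (some (b, y))
      | none => match b with
        | true => bigOr (some (true, x₀)) (modeStates true)
        | false => bigAnd (some (false, x₀)) (modeStates false)
  prio q a _ := match q with
    | none => 0
    | some (b, x) => match act a x, b with
      | some _, true => 0
      | some _, false => 1
      | none, true => 1
      | none, false => 2

variable {act x₀ branch}

lemma threadAut_prio_le (q : Option (Bool × X)) (a : A) (q' : Option (Bool × X)) :
    (threadAut act x₀ branch).prio q a q' ≤ 2 := by
  simp only [threadAut]
  split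
  · simp
  · split <;> simp

lemma threadAut_atoms_alive {b : Bool} {x y : X} {a : A} (h : act a x = some y) :
    ((threadAut act x₀ branch).δ (some (b, x)) a).atoms = {some (b, y)} := by
  simp [threadAut, h, PosBool.atoms]

lemma threadAut_atoms_dead {b : Bool} {x : X} {a : A} (h : act a x = none) {q : Option (Bool × X)}
    (hq : q ∈ ((threadAut act x₀ branch).δ (some (b, x)) a).atoms) : ∃ y, q = some (b, y) := by
  cases b with
  | true =>
    simp only [threadAut, h] at hq
    rcases atoms_bigOr_subset _ _ hq with rfl | hq
    · exact ⟨_, rfl⟩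
    · obtain ⟨y, -, rfl⟩ := List.mem_map.1 hq
      exact ⟨y, rfl⟩
  | false =>
    simp only [threadAut, h] at hq
    rcases atoms_bigAnd_subset _ _ hq with rfl | hq
    · exact ⟨_, rfl⟩
    · obtain ⟨y, -, rfl⟩ := List.mem_map.1 hq
      exact ⟨y, rfl⟩

lemma mem_modeStates (b : Bool) (y : X) : some (b, y) ∈ modeStates (X := X) b :=
  List.mem_map.2 ⟨y, by simp, rfl⟩

lemma exists_eveChoice_jump (q : Option (Bool × X)) (a : A) (y : X) :
    ∃ e : EveChoice ((threadAut act x₀ branch).δ q a),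
      ∀ x, q = some (true, x) → act a x = none → e.outcome = {some (true, y)} := by
  by_cases h : ∃ x, q = some (true, x) ∧ act a x = none
  · obtain ⟨x, rfl, hx⟩ := h
    have hδ : (threadAut act x₀ branch).δ (some (true, x)) a =
        bigOr (some (true, x₀)) (modeStates true) := by simp [threadAut, hx]
    rw [hδ]
    obtain ⟨e, he⟩ := exists_eveChoice_bigOr (some (true, x₀)) (mem_modeStates true y)
    exact ⟨e, fun _ _ _ => he⟩
  · exact ⟨(nonempty_eveChoice _).some, fun x h₁ h₂ => absurd ⟨x, h₁, h₂⟩ h⟩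

lemma exists_adamChoice_jump (q : Option (Bool × X)) (a : A) (y : X) :
    ∃ e : AdamChoice ((threadAut act x₀ branch).δ q a),
      ∀ x, q = some (false, x) → act a x = none → e.outcome = {some (false, y)} := by
  by_cases h : ∃ x, q = some (false, x) ∧ act a x = none
  · obtain ⟨x, rfl, hx⟩ := h
    have hδ : (threadAut act x₀ branch).δ (some (false, x)) a =
        bigAnd (some (false, x₀)) (modeStates false) := by simp [threadAut, hx]
    rw [hδ]
    obtain ⟨e, he⟩ := exists_adamChoice_bigAnd (some (false, x₀)) (mem_modeStates false y)
    exact ⟨e, fun _ _ _ => he⟩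
  · exact ⟨(nonempty_adamChoice _).some, fun x h₁ h₂ => absurd ⟨x, h₁, h₂⟩ h⟩

/-- A path through the automaton follows threads in the mode selected by the first letter. -/
lemma exists_positions_of_path {w : ℕ → A} {ρ : ℕ → Option (Bool × X)} (h0 : ρ 0 = none)
    (hρ : ∀ n, ρ (n + 1) ∈ ((threadAut act x₀ branch).δ (ρ n) (w n)).atoms) :
    ∃ x : ℕ → X, (∀ n, 1 ≤ n → ρ n = some (branch (w 0), x n)) ∧
      ∀ n, 1 ≤ n → ∀ y, act (w n) (x n) = some y → x (n + 1) = y := by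
  have hex : ∀ n, 1 ≤ n → ∃ x, ρ n = some (branch (w 0), x) := by
    intro n hn
    induction n, hn using Nat.le_induction with
    | base =>
      have := hρ 0
      rw [h0] at this
      exact ⟨x₀, this⟩
    | succ n _ ih =>
      obtain ⟨x, hx⟩ := ih
      have h := hρ n
      rw [hx] at h
      cases hc : act (w n) x with
      | none => exact threadAut_atoms_dead hc h
      | some y =>
        rw [threadAut_atoms_alive hc] at h
        exact ⟨y, h⟩
  refine ⟨fun n => ((ρ n).map Prod.snd).getD x₀, fun n hn => ?_, fun n hn y hy => ?_⟩
  · obtain ⟨x, hx⟩ := hex n hn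
    simp [hx]
  · obtain ⟨x, hx⟩ := hex n hn
    have h := hρ n
    simp only [hx, Option.map_some, Option.getD_some] at hy
    rw [hx, threadAut_atoms_alive hy] at h
    simp only [Set.mem_singleton_iff] at h
    simp [h]

/-- Mode `true` accepts if threads are changed finitely often, mode `false` otherwise. -/
lemma acc_path_iff {w : ℕ → A} {ρ : ℕ → Option (Bool × X)} {x : ℕ → X} {b : Bool}
    (hx : ∀ n, 1 ≤ n → ρ n = some (b, x n)) :
    (threadAut act x₀ branch).toAlt.acc (trace w ρ) ↔
      ((∃ M, ∀ n, M ≤ n → act (w n) (x n) ≠ none) ↔ b = true) := by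
  have hprio : ∀ n, 1 ≤ n → (threadAut act x₀ branch).prio (ρ n) (w n) (ρ (n + 1)) =
      (if act (w n) (x n) = none then 1 else 0) + (if b = true then 0 else 1) := by
    intro n hn
    rw [hx n hn]
    cases hc : act (w n) (x n) <;> cases b <;> simp [threadAut, hc]
  change ParityAcc (fun n => (threadAut act x₀ branch).prio (ρ n) (w n) (ρ (n + 1))) ↔ _
  by_cases hM : ∃ M, ∀ n, M ≤ n → act (w n) (x n) ≠ none
  · obtain ⟨M, hM'⟩ := hM
    have hval : ∀ n, M + 1 ≤ n → (threadAut act x₀ branch).prio (ρ n) (w n) (ρ (n + 1)) =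
        if b = true then 0 else 1 := by
      intro n hn
      rw [hprio n (by omega), if_neg (hM' n (by omega)), zero_add]
    rw [parityAcc_iff_even (N := M + 1) (fun n hn => (hval n hn).le)
      fun N => ⟨M + 1 + N, by omega, hval _ (by omega)⟩]
    have : ∃ M, ∀ n, M ≤ n → act (w n) (x n) ≠ none := ⟨M, hM'⟩
    cases b <;> simp [this]
  · have hinf : ∀ N, ∃ n, N ≤ n ∧ act (w n) (x n) = none := by
      push Not at hM
      exact hM
    rw [parityAcc_iff_even (N := 1) (p := 1 + if b = true then 0 else 1)
      (fun n hn => by rw [hprio n hn]; split_ifs <;> omega) fun N => ?_]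
    · cases b <;> simp [hM]
    · obtain ⟨n, hn, hd⟩ := hinf (N + 1)
      exact ⟨n, by omega, by simp only [hprio n (by omega), if_pos hd]⟩

/-- A path on a word without thread is accepting exactly in mode `false`; a path on a word with a
thread is won by the player who moves to the oldest thread. -/
lemma acc_path_of_jumps {w : ℕ → A} {ρ : ℕ → Option (Bool × X)} (h0 : ρ 0 = none)
    (hρ : ∀ n, ρ (n + 1) ∈ ((threadAut act x₀ branch).δ (ρ n) (w n)).atoms)
    (hjump : HasThread act w → ∀ n x, ρ n = some (branch (w 0), x) → act (w n) x = none →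
      ρ (n + 1) = some (branch (w 0), oldestEnd act x₀ (pref w (n + 1)))) :
    (threadAut act x₀ branch).toAlt.acc (trace w ρ) ↔ (HasThread act w ↔ branch (w 0) = true) := by
  obtain ⟨x, hx, hstep⟩ := exists_positions_of_path h0 hρ
  rw [acc_path_iff hx]
  refine iff_congr ⟨fun ⟨M, hM⟩ => ?_, fun h => ?_⟩ Iff.rfl
  · exact hasThread_of_run (max 1 M) (fun n hn => hstep n (le_of_max_le_left hn))
      fun n hn => hM n (le_of_max_le_right hn)
  · refine oldest_run_breaks_finitely x₀ 1 hstep (fun n hn hd => ?_) h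
    have := hjump h n (x n) (hx n hn) hd
    rw [hx (n + 1) (by omega)] at this
    simpa using this

/-- Two strategies with memory of the path determine a common path. -/
lemma exists_path_of_step {Q : Type} (q₀ : Q) (R : List Q → ℕ → Q → Q → Prop)
    (hR : ∀ l n q, ∃ q', R l n q q') :
    ∃ ρ : ℕ → Q, ρ 0 = q₀ ∧ ∀ n, R (pref ρ n) n (ρ n) (ρ (n + 1)) := by
  choose g hg using hR
  let s : ℕ → List Q × Q := fun n => n.rec ([], q₀) fun n s => (s.1 ++ [s.2], g s.1 n s.2)
  have hs : ∀ n, (s n).1 = pref (fun n => (s n).2) n := fun n => by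
    induction n with
    | zero => simp [s, pref]
    | succ n ih => rw [pref_succ, ← ih]
  refine ⟨fun n => (s n).2, rfl, fun n => ?_⟩
  rw [← hs]
  exact hg _ _ _

/-- Eve's strategy of moving to the oldest thread. -/
noncomputable def eveOldest (u : List A) (a : A) (q : Option (Bool × X)) :
    EveChoice ((threadAut act x₀ branch).δ q a) :=
  (exists_eveChoice_jump q a (oldestEnd act x₀ (u ++ [a]))).choose

/-- Adam's strategy of moving to the oldest thread. -/
noncomputable def adamOldest (u : List A) (a : A) (q : Option (Bool × X)) :
    AdamChoice ((threadAut act x₀ branch).δ q a) :=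
  (exists_adamChoice_jump q a (oldestEnd act x₀ (u ++ [a]))).choose

lemma acc_of_eveOldest {w : ℕ → A} {ρ : ℕ → Option (Bool × X)} (h0 : ρ 0 = none)
    (hρ : ∀ n, ρ (n + 1) ∈
      (eveOldest (act := act) (x₀ := x₀) (branch := branch) (pref w n) (w n) (ρ n)).outcome)
    (h : HasThread act w ↔ branch (w 0) = true) :
    (threadAut act x₀ branch).toAlt.acc (trace w ρ) := by
  refine (acc_path_of_jumps h0 (fun n => EveChoice.outcome_subset _ (hρ n)) ?_).2 h
  intro hT n x hx hd
  have hb := h.1 hT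
  rw [hb] at hx ⊢
  have hout := (exists_eveChoice_jump (act := act) (x₀ := x₀) (branch := branch) (ρ n) (w n)
    (oldestEnd act x₀ (pref w n ++ [w n]))).choose_spec x hx hd
  have := hρ n
  rw [eveOldest, hout] at this
  rw [pref_succ]
  exact this

lemma not_acc_of_adamOldest {w : ℕ → A} {ρ : ℕ → Option (Bool × X)} (h0 : ρ 0 = none)
    (hρ : ∀ n, ρ (n + 1) ∈
      (adamOldest (act := act) (x₀ := x₀) (branch := branch) (pref w n) (w n) (ρ n)).outcome)
    (h : ¬ (HasThread act w ↔ branch (w 0) = true)) :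
    ¬ (threadAut act x₀ branch).toAlt.acc (trace w ρ) := by
  refine mt (acc_path_of_jumps h0 (fun n => AdamChoice.outcome_subset _ (hρ n)) ?_).1 h
  intro hT n x hx hd
  have hb : branch (w 0) = false := by simpa [hT] using h
  rw [hb] at hx ⊢
  have hout := (exists_adamChoice_jump (act := act) (x₀ := x₀) (branch := branch) (ρ n) (w n)
    (oldestEnd act x₀ (pref w n ++ [w n]))).choose_spec x hx hd
  have := hρ n
  rw [adamOldest, hout] at this
  rw [pref_succ]
  exact this

lemma threadAut_accepts_iff (w : ℕ → A) :
    (threadAut act x₀ branch).toAlt.Accepts w ↔ (HasThread act w ↔ branch (w 0) = true) := by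
  constructor
  · rintro ⟨σ, hσ⟩
    by_contra h
    obtain ⟨ρ, h0, hρ⟩ := exists_path_of_step (none : Option (Bool × X))
      (fun l n q q' => q' ∈ (σ l n q).outcome ∧ q' ∈ (adamOldest (pref w n) (w n) q).outcome)
      fun l n q => exists_mem_outcome _ _
    exact not_acc_of_adamOldest h0 (fun n => (hρ n).2) h (hσ ρ h0 fun n => (hρ n).1)
  · intro h
    exact ⟨fun _ n q => eveOldest (pref w n) (w n) q, fun ρ h0 hρ => acc_of_eveOldest h0 hρ h⟩

lemma map_fst_ofFn {Q : Type} (w : ℕ → A) (ρ : ℕ → Q) (n : ℕ) :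
    (List.ofFn fun i : Fin n => (w i.val, ρ (i.val + 1))).map Prod.fst = pref w n := by
  rw [List.map_ofFn]
  rfl

lemma threadAut_existsGFG : ExistsGFG (threadAut act x₀ branch).toAlt := by
  refine ⟨fun l a q => eveOldest (l.map Prod.fst) a q, fun w ρ h0 hρ h => ?_⟩
  refine acc_of_eveOldest h0 (fun n => ?_) ((threadAut_accepts_iff w).1 h)
  have := hρ n
  beta_reduce at this
  rwa [map_fst_ofFn] at this

lemma threadAut_forallGFG : ForallGFG (threadAut act x₀ branch).toAlt := by
  refine ⟨fun l a q => adamOldest (l.map Prod.fst) a q, fun w ρ h0 hρ => ?_⟩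
  by_cases h : HasThread act w ↔ branch (w 0) = true
  · exact .inl ((threadAut_accepts_iff w).2 h)
  · refine .inr (not_acc_of_adamOldest h0 (fun n => ?_) h)
    have := hρ n
    beta_reduce at this
    rwa [map_fst_ofFn] at this

end ThreadAutomaton

end GFGPaper

namespace GFGPaper

section Resolvers

variable {A X P : Type}

/-- The infinite word `h` followed by `w`. -/
def appendWord (h : List A) (w : ℕ → A) (n : ℕ) : A := h.getD n (w (n - h.length))

lemma appendWord_add (h : List A) (w : ℕ → A) (n : ℕ) : appendWord h w (h.length + n) = w n := by
  simp [appendWord]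

lemma pref_appendWord (h : List A) (w : ℕ → A) : pref (appendWord h w) h.length = h := by
  refine List.ext_getElem (by simp [pref_length]) fun i _ _ => ?_
  simp [pref, appendWord]

lemma pref_appendWord_add (h : List A) (w : ℕ → A) (n : ℕ) :
    pref (appendWord h w) (h.length + n) = h ++ pref w n := by
  simp only [pref_add, pref_appendWord, appendWord_add]

lemma hasThread_appendWord_iff {act : A → X → Option X} (h : List A) (w : ℕ → A) :
    HasThread act (appendWord h w) ↔ HasThread act w := by
  have hw : (fun n => appendWord h w (h.length + n)) = w := funext (appendWord_add h w)
  refine ⟨fun hT => ?_, fun hT => .of_shift h.length (by rwa [hw])⟩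
  have := hT.shift h.length
  rwa [hw] at this

/-- A resolver whose run rejects the words without thread after a letter `a₀`, in an automaton
all of whose runs accept the words with a thread after `a₀`, uses many states. -/
lemma two_pow_le_card_of_resolver [Fintype X] [Fintype P] {act : A → X → Option X}
    {prio : P → A → P → ℕ} {f : List A → P} {m B : ℕ} (a₀ : A) (hm : 0 < m)
    (hinj : ∀ a x x' y, act a x = some y → act a x' = some y → x = x')
    (hX : Fintype.card X = 3 * m)
    (hperm : ∀ σ : Equiv.Perm X, ∃ v, ∀ x, runWord act v x = some (σ x))
    (hkill : ∀ D : Finset X, ∃ v, ∀ x, (x ∈ D → runWord act v x = some x) ∧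
      (x ∉ D → runWord act v x = none))
    (htotal : ∃ a, ∀ x, (act a x).isSome) (hB : ∀ p a q, prio p a q < B)
    {Δ : P → A → Set P} (hΔ : ∀ u a, f (u ++ [a]) ∈ Δ (f u) a)
    (haccept : ∀ (w : ℕ → A) (ρ : ℕ → P), w 0 = a₀ → ρ 0 = f [] →
      (∀ n, ρ (n + 1) ∈ Δ (ρ n) (w n)) → HasThread act w →
      ParityAcc fun n => prio (ρ n) (w n) (ρ (n + 1)))
    (hreject : ∀ w : ℕ → A, w 0 = a₀ → ¬ HasThread act w →
      ¬ ParityAcc fun n => prio (f (pref w n)) (w n) (f (pref w (n + 1)))) :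
    2 ^ m ≤ Fintype.card P := by
  refine two_pow_le_card_of_separating (f := f) (C := {h | ∃ u, h = a₀ :: u}) hm hinj hX hperm
    hkill htotal hB ⟨[a₀], [], rfl⟩ ?_ ?_ ?_
  · rintro _ ⟨u, rfl⟩ a
    exact ⟨u ++ [a], rfl⟩
  · intro q w g hg hT
    obtain ⟨⟨u, hu⟩, h0, -⟩ := hg 0
    set h := g 0
    have hpos : 0 < h.length := by simp [hu]
    let ρ : ℕ → P := fun n => if n < h.length then f (pref (appendWord h w) n) else q (n - h.length)
    have hρ : ∀ n, ρ (n + h.length) = q n := fun n => by simp [ρ]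
    have hw : ∀ n, appendWord h w (n + h.length) = w n := fun n => by
      rw [add_comm, appendWord_add]
    have hrun : ∀ n, ρ (n + 1) ∈ Δ (ρ n) (appendWord h w n) := by
      intro n
      rcases lt_or_ge n h.length with hn | hn
      · have h1 : ρ (n + 1) = f (pref (appendWord h w) n ++ [appendWord h w n]) := by
          rw [← pref_succ]
          rcases (Nat.succ_le_of_lt hn).lt_or_eq with hn' | hn'
          · exact if_pos hn'
          · have : n + 1 = 0 + h.length := by omega
            rw [this, hρ, ← h0, zero_add, pref_appendWord]
        rw [h1, show ρ n = f (pref (appendWord h w) n) from if_pos hn]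
        exact hΔ _ _
      · obtain ⟨k, rfl⟩ := Nat.exists_eq_add_of_le' hn
        rw [add_right_comm, hρ, hρ, hw, ← (hg k).2.1, ← (hg k).2.2]
        exact hΔ _ _
    have hacc := haccept (appendWord h w) ρ (by simp [appendWord, hu])
      (by simp [ρ, hpos, pref]) hrun ((hasThread_appendWord_iff h w).2 hT)
    rw [← parityAcc_shift h.length] at hacc
    simpa only [add_right_comm _ h.length 1, hρ, hw] using hacc
  · rintro h ⟨u, hu⟩ w hT hacc
    refine hreject (appendWord h w) (by simp [appendWord, hu])
      (mt (hasThread_appendWord_iff h w).1 hT) ?_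
    rw [← parityAcc_shift h.length]
    simpa only [add_right_comm _ h.length 1, add_comm _ h.length, pref_appendWord_add,
      appendWord_add, add_assoc] using hacc

lemma exists_prio_bound [Finite A] [Finite P] (prio : P → A → P → ℕ) :
    ∃ B, ∀ p a q, prio p a q < B := by
  obtain ⟨B, hB⟩ := (Set.finite_range fun t : P × A × P => prio t.1 t.2.1 t.2.2).bddAbove
  exact ⟨B + 1, fun p a q => Nat.lt_succ_of_le (hB ⟨(p, a, q), rfl⟩)⟩

end Resolvers

section Family

variable {n : ℕ}

lemma UPA.two_pow_le_card {P : Type} [Fintype P] (U : UPA (Fin 3) P)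
    (hL : ∀ w, U.Accepts w ↔ (HasThread (letterAct (3 * n + 1)) w ↔ w 0 = 0)) (hU : U.GFG) :
    2 ^ (n + 1) ≤ Fintype.card P := by
  obtain ⟨f, hf0, hΔ, hf⟩ := hU
  obtain ⟨B, hB⟩ := exists_prio_bound U.prio
  refine two_pow_le_card_of_resolver (act := letterAct (3 * n + 1)) (f := f) 0 n.succ_pos
    letterAct_inj (by simp; ring) exists_word_of_perm exists_word_killing
    ⟨0, fun x => by simp [letterAct]⟩ hB hΔ (fun w ρ h0 hρ0 hρ hT => ?_) fun w h0 hT => ?_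
  · exact (hL w).2 (iff_of_true hT h0) ρ ⟨hρ0.trans hf0, hρ⟩
  · exact hf w fun h => hT (((hL w).1 h).2 h0)

lemma NPA.two_pow_le_card {P : Type} [Fintype P] (N : NPA (Fin 3) P)
    (hL : ∀ w, N.Accepts w ↔ (HasThread (letterAct (3 * n + 1)) w ↔ w 0 = 0)) (hN : N.GFG) :
    2 ^ (n + 1) ≤ Fintype.card P := by
  obtain ⟨f, hf0, hΔ, hf⟩ := hN
  obtain ⟨B, hB⟩ := exists_prio_bound N.prio
  refine two_pow_le_card_of_resolver (act := letterAct (3 * n + 1)) (f := f)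
    (prio := fun p a q => N.prio p a q + 1) 1 n.succ_pos
    letterAct_inj (by simp; ring) exists_word_of_perm exists_word_killing
    ⟨0, fun x => by simp [letterAct]⟩ (fun p a q => Nat.succ_lt_succ (hB p a q)) hΔ
    (fun w ρ h0 hρ0 hρ hT => ?_) fun w h0 hT => ?_
  · rw [parityAcc_succ fun n => hB _ _ _]
    intro hacc
    have := ((hL w).1 ⟨ρ, ⟨hρ0.trans hf0, hρ⟩, hacc⟩).1 hT
    rw [h0] at this
    exact absurd this (by decide)
  · rw [parityAcc_succ fun n => hB _ _ _, not_not]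
    refine hf w ((hL w).2 (iff_of_false hT ?_))
    rw [h0]
    decide

end Family

end GFGPaper

namespace GFGPaper

/-- there is a family `(C_n)` of alternating GFG parity automata
with priorities `{0,1,2}`, of size linear in `n` over a fixed alphabet, such
that every nondeterministic GFG parity automaton and every universal GFG parity
automaton for `L(C_n)` has at least `2^{Ω(n)}` states. -/
theorem succinct_alternating_gfg_family :
    ∃ (A : Type) (iA : Fintype A) (c : ℕ), 0 < c ∧
      ∀ n : ℕ, ∃ (Q : Type) (iQ : Fintype Q) (M : APW A Q),
        @Fintype.card Q iQ ≤ c * (n + 1) ∧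
        (∀ q a q', M.prio q a q' ≤ 2) ∧
        ExistsGFG M.toAlt ∧ ForallGFG M.toAlt ∧
        (∀ (P : Type) (iP : Fintype P) (N : NPA A P),
          (∀ w, N.Accepts w ↔ M.Accepts w) → N.GFG →
          2 ^ (n / c) ≤ @Fintype.card P iP) ∧
        (∀ (P : Type) (iP : Fintype P) (U : UPA A P),
          (∀ w, U.Accepts w ↔ M.Accepts w) → U.GFG →
          2 ^ (n / c) ≤ @Fintype.card P iP) := by
  refine ⟨Fin 3, inferInstance, 7, by norm_num, fun n =>
    ⟨Option (Bool × Fin (3 * n + 1 + 2)), inferInstance,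
      threadAut (letterAct (3 * n + 1)) 0 fun a => decide (a = 0), ?_,
      threadAut_prio_le, threadAut_existsGFG, threadAut_forallGFG, ?_, ?_⟩⟩
  · simp
    omega
  all_goals
    intro P iP N hL hN
    refine (Nat.pow_le_pow_right two_pos ((Nat.div_le_self n 7).trans n.le_succ)).trans
      (N.two_pow_le_card (n := n) (fun w => ?_) hN)
    rw [hL, APW.Accepts, threadAut_accepts_iff, decide_eq_true_iff]

end GFGPaper
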